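/- Let X=(P,Q,R) be a homogeneous polynomial vector field on S² of degree 2 and let n∈S² be a unit vector, with C = {p∈S² : ⟨n,p⟩ = 0} the corresponding great circle. Then either ⟨n, X(p)⟩ = 0 for all p∈C (so that C is formed by orbits of X), or the set {p∈C : ⟨n, X(p)⟩ = 0} of tangency points of C with the orbits of X has at most four elements. -/

import Mathlib

open MvPolynomial

/-- The sphere `S² ⊆ ℝ³`. -/
def S2 : Set (Fin 3 → ℝ) := {p | p 0 ^ 2 + p 1 ^ 2 + p 2 ^ 2 = 1}

/-- Euclidean dot product on `ℝ³`. -/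
def dot3 (m p : Fin 3 → ℝ) : ℝ := m 0 * p 0 + m 1 * p 1 + m 2 * p 2

/-- The vector field in `ℝ³` associated to the polynomials `P`, `Q`, `R`. -/
noncomputable def Xf (P Q R : MvPolynomial (Fin 3) ℝ) (p : Fin 3 → ℝ) : Fin 3 → ℝ :=
  ![eval p P, eval p Q, eval p R]

/-- A ternary quadratic form restricted to the span of two vectors is a binary quadratic form. -/
theorem exists_eval_smul_add_smul_of_isHomogeneous_two {F : MvPolynomial (Fin 3) ℝ}
    (hF : F.IsHomogeneous 2) (u v : Fin 3 → ℝ) :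
    ∃ b : ℝ, ∀ s t : ℝ,
      eval (s • u + t • v) F = s ^ 2 * eval u F + s * t * b + t ^ 2 * eval v F := by
  have key : ∀ d ∈ F.support, ∃ b : ℝ, ∀ s t : ℝ,
      ∏ i, (s • u + t • v) i ^ d i = s ^ 2 * ∏ i, u i ^ d i + s * t * b + t ^ 2 * ∏ i, v i ^ d i := by
    intro d hd
    have hdeg : d 0 + d 1 + d 2 = 2 := by
      have h := hF (mem_support_iff.mp hd)
      rw [Finsupp.weight_apply, Finsupp.sum_fintype _ _ (by simp)] at h
      simpa [Fin.sum_univ_three] using h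
    simp only [Fin.prod_univ_three, Pi.add_apply, Pi.smul_apply, smul_eq_mul]
    have hcases : ∃ i j : Fin 3, ∀ w : Fin 3 → ℝ,
        w 0 ^ d 0 * w 1 ^ d 1 * w 2 ^ d 2 = w i * w j := by
      obtain ⟨h0, h1, h2⟩ | ⟨h0, h1, h2⟩ | ⟨h0, h1, h2⟩ | ⟨h0, h1, h2⟩ | ⟨h0, h1, h2⟩ |
          ⟨h0, h1, h2⟩ : (d 0 = 2 ∧ d 1 = 0 ∧ d 2 = 0) ∨ (d 0 = 0 ∧ d 1 = 2 ∧ d 2 = 0) ∨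
          (d 0 = 0 ∧ d 1 = 0 ∧ d 2 = 2) ∨ (d 0 = 1 ∧ d 1 = 1 ∧ d 2 = 0) ∨
          (d 0 = 1 ∧ d 1 = 0 ∧ d 2 = 1) ∨ (d 0 = 0 ∧ d 1 = 1 ∧ d 2 = 1) := by omega
      · exact ⟨0, 0, fun w => by rw [h0, h1, h2]; ring⟩
      · exact ⟨1, 1, fun w => by rw [h0, h1, h2]; ring⟩
      · exact ⟨2, 2, fun w => by rw [h0, h1, h2]; ring⟩
      · exact ⟨0, 1, fun w => by rw [h0, h1, h2]; ring⟩
      · exact ⟨0, 2, fun w => by rw [h0, h1, h2]; ring⟩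
      · exact ⟨1, 2, fun w => by rw [h0, h1, h2]; ring⟩
    obtain ⟨i, j, hij⟩ := hcases
    refine ⟨u i * v j + v i * u j, fun s t => ?_⟩
    rw [hij u, hij v, hij fun k => s * u k + t * v k]
    ring
  choose! b hb using key
  refine ⟨∑ d ∈ F.support, coeff d F * b d, fun s t => ?_⟩
  simp only [eval_eq', Finset.mul_sum, ← Finset.sum_add_distrib]
  refine Finset.sum_congr rfl fun d hd => ?_
  rw [hb d hd]
  ring

/-- `u` and `m × u` form an orthonormal basis of the plane orthogonal to `m`. -/
theorem exists_eq_smul_add_smul_of_dot3_eq_zero {m u : Fin 3 → ℝ} (hm : m ∈ S2) (hu : u ∈ S2)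
    (hmu : dot3 m u = 0) {p : Fin 3 → ℝ} (hp : p ∈ S2) (hmp : dot3 m p = 0) :
    ∃ s t : ℝ, s ^ 2 + t ^ 2 = 1 ∧ p = s • u + t • crossProduct m u := by
  simp only [S2, Set.mem_ofPred_eq, dot3] at hm hu hmu hp hmp
  set v := crossProduct m u with hv
  have hv0 : v 0 = m 1 * u 2 - m 2 * u 1 := by simp [hv, cross_apply]
  have hv1 : v 1 = m 2 * u 0 - m 0 * u 2 := by simp [hv, cross_apply]
  have hv2 : v 2 = m 0 * u 1 - m 1 * u 0 := by simp [hv, cross_apply]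
  have hvv : v 0 * v 0 + v 1 * v 1 + v 2 * v 2 = 1 := by
    rw [hv0, hv1, hv2]
    linear_combination (u 0 ^ 2 + u 1 ^ 2 + u 2 ^ 2) * hm + hu -
      (m 0 * u 0 + m 1 * u 1 + m 2 * u 2) * hmu
  have hmv : m 0 * v 0 + m 1 * v 1 + m 2 * v 2 = 0 := by rw [hv0, hv1, hv2]; ring
  have huv : u 0 * v 0 + u 1 * v 1 + u 2 * v 2 = 0 := by rw [hv0, hv1, hv2]; ring
  have horth : (Matrix.of ![m, u, v]) * (Matrix.of ![m, u, v]).transpose = 1 := by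
    ext i j
    fin_cases i <;> fin_cases j <;>
      simp [Matrix.mul_apply, Fin.sum_univ_three] <;> linarith
  have hid := mul_eq_one_comm.mp horth
  have hentry (i j : Fin 3) : m i * m j + u i * u j + v i * v j = (1 : Matrix _ _ ℝ) i j := by
    simpa [Matrix.mul_apply, Fin.sum_univ_three] using congrFun (congrFun hid i) j
  have hdecomp : p = (u 0 * p 0 + u 1 * p 1 + u 2 * p 2) • u +
      (v 0 * p 0 + v 1 * p 1 + v 2 * p 2) • v := by
    have hsum (i : Fin 3) : p i = ∑ j, (1 : Matrix (Fin 3) (Fin 3) ℝ) i j * p j := by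
      simp [Matrix.one_apply]
    funext i
    rw [hsum i]
    simp only [← hentry, Fin.sum_univ_three, Pi.add_apply, Pi.smul_apply, smul_eq_mul]
    linear_combination m i * hmp
  refine ⟨_, _, ?_, hdecomp⟩
  have h (i : Fin 3) := congrFun hdecomp i
  simp only [Pi.add_apply, Pi.smul_apply, smul_eq_mul] at h
  linear_combination hp - p 0 * h 0 - p 1 * h 1 - p 2 * h 2

/-- A nonzero linear form `b s + c t` has only two zeros on the unit circle. -/
theorem eq_or_eq_neg_of_linear_form_eq_zero {b c s t : ℝ} (hbc : b ^ 2 + c ^ 2 ≠ 0)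
    (hst : s ^ 2 + t ^ 2 = 1) (h : b * s + c * t = 0) :
    (s = -c / √(b ^ 2 + c ^ 2) ∧ t = b / √(b ^ 2 + c ^ 2)) ∨
      (s = -(-c / √(b ^ 2 + c ^ 2)) ∧ t = -(b / √(b ^ 2 + c ^ 2))) := by
  have hr2 : √(b ^ 2 + c ^ 2) ^ 2 = b ^ 2 + c ^ 2 := Real.sq_sqrt (by positivity)
  have hr : √(b ^ 2 + c ^ 2) ≠ 0 := fun h0 => hbc (by rw [← hr2, h0]; ring)
  generalize √(b ^ 2 + c ^ 2) = r at hr2 hr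
  have hk : (b * t - c * s) ^ 2 = r ^ 2 := by
    rw [hr2]
    linear_combination (b ^ 2 + c ^ 2) * hst - (b * s + c * t) * h
  have hs : s * r ^ 2 = -c * (b * t - c * s) := by rw [hr2]; linear_combination b * h
  have ht : t * r ^ 2 = b * (b * t - c * s) := by rw [hr2]; linear_combination c * h
  rcases sq_eq_sq_iff_eq_or_eq_neg.mp hk with hk | hk <;> rw [hk] at hs ht
  · left
    constructor <;> rw [eq_div_iff hr] <;> apply mul_right_cancel₀ hr <;> linarith
  · right
    constructor <;> rw [← neg_div, eq_div_iff hr] <;> apply mul_right_cancel₀ hr <;> linarith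

/-- For a homogeneous polynomial vector field `X` of degree 2 on `S²` and a
great circle `C = {p ∈ S² : ⟨m,p⟩ = 0}` (`m` a unit vector), either `C` is formed by orbits of
`X` (i.e. `⟨m, X(p)⟩ = 0` for all `p ∈ C`), or `C` has at most four tangency points with the
orbits of `X`. -/
theorem stmt13 (P Q R : MvPolynomial (Fin 3) ℝ)
    (hP : P.IsHomogeneous 2) (hQ : Q.IsHomogeneous 2) (hR : R.IsHomogeneous 2)
    (htan : ∀ p : Fin 3 → ℝ, p ∈ S2 →
      p 0 * eval p P + p 1 * eval p Q + p 2 * eval p R = 0)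
    (m : Fin 3 → ℝ) (hm : m ∈ S2) :
    (∀ p ∈ S2, dot3 m p = 0 → dot3 m (Xf P Q R p) = 0) ∨
    ({p ∈ S2 | dot3 m p = 0 ∧ dot3 m (Xf P Q R p) = 0}.Finite ∧
      {p ∈ S2 | dot3 m p = 0 ∧ dot3 m (Xf P Q R p) = 0}.ncard ≤ 4) := by
  set Z := {p ∈ S2 | dot3 m p = 0 ∧ dot3 m (Xf P Q R p) = 0} with hZ
  rcases Z.eq_empty_or_nonempty with hempty | ⟨u, hu, hmu, hXu⟩
  · right
    simp [hempty]
  obtain ⟨bP, hbP⟩ := exists_eval_smul_add_smul_of_isHomogeneous_two hP u (crossProduct m u)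
  obtain ⟨bQ, hbQ⟩ := exists_eval_smul_add_smul_of_isHomogeneous_two hQ u (crossProduct m u)
  obtain ⟨bR, hbR⟩ := exists_eval_smul_add_smul_of_isHomogeneous_two hR u (crossProduct m u)
  set v := crossProduct m u
  obtain ⟨b, c, hX⟩ : ∃ b c : ℝ, ∀ s t : ℝ,
      dot3 m (Xf P Q R (s • u + t • v)) = t * (b * s + c * t) := by
    refine ⟨m 0 * bP + m 1 * bQ + m 2 * bR, dot3 m (Xf P Q R v), fun s t => ?_⟩
    simp only [dot3, Xf, Matrix.cons_val] at hXu ⊢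
    rw [hbP, hbQ, hbR]
    linear_combination s ^ 2 * hXu
  by_cases hbc : b ^ 2 + c ^ 2 = 0
  · left
    have hb : b = 0 := by nlinarith [sq_nonneg b, sq_nonneg c]
    have hc : c = 0 := by nlinarith [sq_nonneg b, sq_nonneg c]
    intro p hp hmp
    obtain ⟨s, t, -, rfl⟩ := exists_eq_smul_add_smul_of_dot3_eq_zero hm hu hmu hp hmp
    rw [hX, hb, hc]
    ring
  right
  classical
  set w := (-c / √(b ^ 2 + c ^ 2)) • u + (b / √(b ^ 2 + c ^ 2)) • v
  have hsub : Z ⊆ (({u, -u, w, -w} : Finset (Fin 3 → ℝ)) : Set (Fin 3 → ℝ)) := by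
    rintro p ⟨hp, hmp, hXp⟩
    obtain ⟨s, t, hst, rfl⟩ := exists_eq_smul_add_smul_of_dot3_eq_zero hm hu hmu hp hmp
    rw [hX] at hXp
    simp only [Finset.coe_insert, Finset.coe_singleton, Set.mem_insert_iff, Set.mem_singleton_iff]
    rcases mul_eq_zero.mp hXp with rfl | hlin
    · have hs : s ^ 2 = 1 := by linarith
      rcases eq_or_eq_neg_of_sq_eq_sq s 1 (by rw [hs, one_pow]) with rfl | rfl <;> simp
    · rcases eq_or_eq_neg_of_linear_form_eq_zero hbc hst hlin with ⟨hs, ht⟩ | ⟨hs, ht⟩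
      · right; right; left
        rw [hs, ht]
      · right; right; right
        rw [hs, ht, neg_smul, neg_smul, ← neg_add]
  refine ⟨(Finset.finite_toSet _).subset hsub, ?_⟩
  calc Z.ncard ≤ _ := Set.ncard_le_ncard hsub (Finset.finite_toSet _)
    _ ≤ 4 := by rw [Set.ncard_coe_finset]; exact Finset.card_le_four
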